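/- arXiv:1507.06541 — 2 statements merged into one kernel-verified Lean document; each statement's English description precedes it below -/
import Mathlib

section
/- Under the standing setup with N_4 = ∅ and S_3 = ∅, assume that for all i ≠ j no vertex of T_i is adjacent to two distinct vertices of T_j, that there are adjacent vertices t_1 ∈ T_1 and t_2 ∈ T_2, and let G' be the subgraph of G induced by the vertices distinct from and nonadjacent to both t_1 and t_2. Then for every i ∈ {3,…,k}, inside G': (i) if t,t' ∈ T_i ∩ V(G') are adjacent, then neither t nor t' has a neighbor in (T_3 ∪ … ∪ T_k) \ T_i within G'; (ii) every vertex of T_i ∩ V(G') has at most one neighbor in ((T_3 ∪ … ∪ T_k) \ T_i) ∩ V(G'). -/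
open SimpleGraph

/-- `M` is a dominating induced matching (d.i.m.) of `G`: every edge of `G` shares an
endpoint with exactly one edge of `M`. -/
def IsDIM {V : Type*} (G : SimpleGraph V) (M : Set (Sym2 V)) : Prop :=
  M ⊆ G.edgeSet ∧ ∀ e ∈ G.edgeSet, ∃! f, f ∈ M ∧ ∃ v, v ∈ e ∧ v ∈ f

/-- `V(M)`: the set of endpoints of edges of `M`. -/
def MVerts {V : Type*} (M : Set (Sym2 V)) : Set V := {v | ∃ e ∈ M, v ∈ e}

/-- The distance level `N_i(xy) = {z | dist(z,{x,y}) = i}`. -/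
def distLevel {V : Type*} (G : SimpleGraph V) (x y : V) (i : ℕ) : Set V :=
  {z : V | min (G.dist z x) (G.dist z y) = i}

/-- `c` lists the vertices of a chordless (induced) cycle of length `n` in `G`. -/
def IsInducedCycle {V : Type*} (G : SimpleGraph V) (n : ℕ) (c : ZMod n → V) : Prop :=
  Function.Injective c ∧ ∀ i j : ZMod n, G.Adj (c i) (c j) ↔ (j = i + 1 ∨ i = j + 1)

/-- The diamond: vertices 0,1,2,3 and edges 01,02,12,13,23 (mid-edge 12). -/
def diamondGraph : SimpleGraph (Fin 4) :=
  SimpleGraph.fromEdgeSet {s(0,1), s(0,2), s(1,2), s(1,3), s(2,3)}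

/-- The butterfly: vertices 0,1,2,3,4 and edges 01,02,12,23,24,34. -/
def butterflyGraph : SimpleGraph (Fin 5) :=
  SimpleGraph.fromEdgeSet {s(0,1), s(0,2), s(1,2), s(2,3), s(2,4), s(3,4)}

/-- The gem: a path 0-1-2-3 plus the universal vertex 4. -/
def gemGraph : SimpleGraph (Fin 5) :=
  SimpleGraph.fromEdgeSet {s(0,1), s(1,2), s(2,3), s(4,0), s(4,1), s(4,2), s(4,3)}

/-- `T_w`: the vertices of `N_3(xy)` whose neighborhood in `N_2(xy)` is exactly `{w}`. -/
def Tset {V : Type*} (G : SimpleGraph V) (x y : V) (w : V) : Set V :=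
  {t | t ∈ distLevel G x y 3 ∧ G.neighborSet t ∩ distLevel G x y 2 = {w}}

/-- The vertices distinct from and nonadjacent to both `t1` and `t2`
(the vertex set of `G'`). -/
def avoidSet {V : Type*} (G : SimpleGraph V) (t1 t2 : V) : Set V :=
  {v | v ≠ t1 ∧ v ≠ t2 ∧ ¬ G.Adj v t1 ∧ ¬ G.Adj v t2}

theorem not_inducedPath_eight {V : Type*} {G : SimpleGraph V}
    (hP8 : IsEmpty (SimpleGraph.pathGraph 8 ↪g G)) (p : Fin 8 → V)
    (hadj : ∀ i j : Fin 8, i < j → (G.Adj (p i) (p j) ↔ i.val + 1 = j.val)) : False := by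
  have hiff : ∀ i j : Fin 8, G.Adj (p i) (p j) ↔ (SimpleGraph.pathGraph 8).Adj i j := by
    intro i j
    rw [SimpleGraph.pathGraph_adj]
    rcases lt_trichotomy i j with h | h | h
    · rw [hadj i j h]; omega
    · subst h; simp
    · rw [G.adj_comm, hadj j i h]; omega
  have hsep : ∀ i j : Fin 8, i ≠ j →
      ∃ l : Fin 8, ¬ ((i.val + 1 = l.val ∨ l.val + 1 = i.val) ↔
        (j.val + 1 = l.val ∨ l.val + 1 = j.val)) := by decide
  have hinj : Function.Injective p := by
    intro i j hij
    by_contra hne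
    obtain ⟨l, hl⟩ := hsep i j hne
    apply hl
    rw [← SimpleGraph.pathGraph_adj, ← SimpleGraph.pathGraph_adj, ← hiff, ← hiff, hij]
  exact hP8.false ⟨⟨p, hinj⟩, hiff _ _⟩

theorem not_inducedPath_eight_vertices {V : Type*} {G : SimpleGraph V}
    (hP8 : IsEmpty (SimpleGraph.pathGraph 8 ↪g G)) {a b c d e f g h : V}
    (path : G.Adj a b ∧ G.Adj b c ∧ G.Adj c d ∧ G.Adj d e ∧ G.Adj e f ∧ G.Adj f g ∧ G.Adj g h)
    (ha : ¬ G.Adj a c ∧ ¬ G.Adj a d ∧ ¬ G.Adj a e ∧ ¬ G.Adj a f ∧ ¬ G.Adj a g ∧ ¬ G.Adj a h)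
    (hb : ¬ G.Adj b d ∧ ¬ G.Adj b e ∧ ¬ G.Adj b f ∧ ¬ G.Adj b g ∧ ¬ G.Adj b h)
    (hc : ¬ G.Adj c e ∧ ¬ G.Adj c f ∧ ¬ G.Adj c g ∧ ¬ G.Adj c h)
    (hd : ¬ G.Adj d f ∧ ¬ G.Adj d g ∧ ¬ G.Adj d h)
    (he : ¬ G.Adj e g ∧ ¬ G.Adj e h) (hf : ¬ G.Adj f h) : False := by
  refine not_inducedPath_eight hP8 ![a, b, c, d, e, f, g, h] ?_
  intro i j hij
  fin_cases i <;> fin_cases j <;> simp_all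

section Levels

variable {V : Type*} {G : SimpleGraph V} {x y : V}

theorem distLevel_le_succ_of_adj (hconn : G.Connected) {a b : V} {i j : ℕ}
    (ha : a ∈ distLevel G x y i) (hb : b ∈ distLevel G x y j) (hab : G.Adj a b) :
    i ≤ j + 1 := by
  have hd : G.dist a b = 1 := SimpleGraph.dist_eq_one_iff_adj.mpr hab
  have hx := hconn.dist_triangle (u := a) (v := b) (w := x)
  have hy := hconn.dist_triangle (u := a) (v := b) (w := y)
  simp only [distLevel, Set.mem_ofPred_eq] at ha hb
  omega

theorem not_adj_of_distLevel (hconn : G.Connected) {a b : V} {i j : ℕ}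
    (ha : a ∈ distLevel G x y i) (hb : b ∈ distLevel G x y j) (hij : j + 1 < i) :
    ¬ G.Adj a b := fun hab => by
  have := distLevel_le_succ_of_adj hconn ha hb hab
  omega

theorem left_mem_distLevel_zero : x ∈ distLevel G x y 0 := by
  simp [distLevel]

theorem right_mem_distLevel_zero : y ∈ distLevel G x y 0 := by
  simp [distLevel]

theorem distLevel_unique {a : V} {i j : ℕ} (hi : a ∈ distLevel G x y i)
    (hj : a ∈ distLevel G x y j) : i = j := by
  simp only [distLevel, Set.mem_ofPred_eq] at hi hj
  omega

theorem adj_of_mem_distLevel_one {a : V} (ha : a ∈ distLevel G x y 1) :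
    G.Adj a x ∨ G.Adj a y := by
  simp only [distLevel, Set.mem_ofPred_eq] at ha
  rw [← SimpleGraph.dist_eq_one_iff_adj, ← SimpleGraph.dist_eq_one_iff_adj]
  omega

theorem exists_adj_mem_distLevel (hconn : G.Connected) {a : V} {i : ℕ}
    (ha : a ∈ distLevel G x y (i + 1)) : ∃ b ∈ distLevel G x y i, G.Adj a b := by
  have closer : ∀ z : V, G.dist a z = i + 1 → ∃ b, G.Adj a b ∧ G.dist b z ≤ i := by
    intro z hz
    obtain ⟨w, hw⟩ := hconn.exists_walk_length_eq_dist a z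
    rw [hz] at hw
    cases w with
    | nil => simp at hw
    | cons h w' =>
      refine ⟨_, h, ?_⟩
      rw [SimpleGraph.Walk.length_cons] at hw
      have := SimpleGraph.dist_le w'
      omega
  have ha' : min (G.dist a x) (G.dist a y) = i + 1 := ha
  have key : ∃ b, G.Adj a b ∧ (G.dist b x ≤ i ∨ G.dist b y ≤ i) := by
    by_cases h : G.dist a x = i + 1
    · obtain ⟨b, hb, hle⟩ := closer x h
      exact ⟨b, hb, Or.inl hle⟩
    · obtain ⟨b, hb, hle⟩ := closer y (by omega)
      exact ⟨b, hb, Or.inr hle⟩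
  obtain ⟨b, hb, hle⟩ := key
  have hlow := distLevel_le_succ_of_adj hconn ha
    (show b ∈ distLevel G x y (min (G.dist b x) (G.dist b y)) from rfl) hb
  refine ⟨b, ?_, hb⟩
  simp only [distLevel, Set.mem_ofPred_eq]
  omega

/-- An edge `p q` and a chordless path `a t s` in `N₃`, anticomplete to each other and hanging off
distinct vertices of `N₂`, are joined through `N₂ ∪ N₁ ∪ {x, y}` to an induced `P₈`. -/
theorem false_of_edge_and_path_in_distLevel_three (hconn : G.Connected)
    (hP8 : IsEmpty (SimpleGraph.pathGraph 8 ↪g G)) (hxy : G.Adj x y)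
    (hN1 : ∀ a ∈ distLevel G x y 1, ∀ b ∈ distLevel G x y 1, ¬ G.Adj a b)
    {U W p q a t s : V}
    (hU : U ∈ distLevel G x y 2) (hW : W ∈ distLevel G x y 2) (hUW : ¬ G.Adj U W)
    (hp : p ∈ distLevel G x y 3) (hq : q ∈ distLevel G x y 3)
    (ha : a ∈ distLevel G x y 3) (ht : t ∈ distLevel G x y 3) (hs : s ∈ distLevel G x y 3)
    (hpq : G.Adj p q) (hqU : G.Adj q U) (hWa : G.Adj W a) (hat : G.Adj a t) (hts : G.Adj t s)
    (has : ¬ G.Adj a s)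
    (hpU : ¬ G.Adj p U) (hpW : ¬ G.Adj p W) (hqW : ¬ G.Adj q W)
    (haU : ¬ G.Adj U a) (htU : ¬ G.Adj U t) (hsU : ¬ G.Adj U s)
    (htW : ¬ G.Adj W t) (hsW : ¬ G.Adj W s)
    (hpa : ¬ G.Adj p a) (hpt : ¬ G.Adj p t) (hps : ¬ G.Adj p s)
    (hqa : ¬ G.Adj q a) (hqt : ¬ G.Adj q t) (hqs : ¬ G.Adj q s) : False := by
  obtain ⟨n, hn, hUn⟩ := exists_adj_mem_distLevel hconn hU
  obtain ⟨m, hm, hWm⟩ := exists_adj_mem_distLevel hconn hW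
  have far31 : ∀ {v w : V}, v ∈ distLevel G x y 3 → w ∈ distLevel G x y 1 → ¬ G.Adj v w :=
    fun hv hw => not_adj_of_distLevel hconn hv hw (by omega)
  have far13 : ∀ {v w : V}, w ∈ distLevel G x y 1 → v ∈ distLevel G x y 3 → ¬ G.Adj w v :=
    fun hw hv h => far31 hv hw h.symm
  by_cases hWn : G.Adj n W
  · exact not_inducedPath_eight_vertices hP8 (a := p) (b := q) (c := U) (d := n) (e := W)
      (f := a) (g := t) (h := s) ⟨hpq, hqU, hUn, hWn, hWa, hat, hts⟩
      ⟨hpU, far31 hp hn, hpW, hpa, hpt, hps⟩ ⟨far31 hq hn, hqW, hqa, hqt, hqs⟩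
      ⟨hUW, haU, htU, hsU⟩ ⟨far13 hn ha, far13 hn ht, far13 hn hs⟩ ⟨htW, hsW⟩ has
  by_cases hUm : G.Adj U m
  · exact not_inducedPath_eight_vertices hP8 (a := p) (b := q) (c := U) (d := m) (e := W)
      (f := a) (g := t) (h := s) ⟨hpq, hqU, hUm, hWm.symm, hWa, hat, hts⟩
      ⟨hpU, far31 hp hm, hpW, hpa, hpt, hps⟩ ⟨far31 hq hm, hqW, hqa, hqt, hqs⟩
      ⟨hUW, haU, htU, hsU⟩ ⟨far13 hm ha, far13 hm ht, far13 hm hs⟩ ⟨htW, hsW⟩ has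
  have common : ∀ z ∈ distLevel G x y 0, G.Adj n z → G.Adj m z → False := by
    intro z hz hnz hmz
    have far : ∀ {v : V} {i : ℕ}, 2 ≤ i → v ∈ distLevel G x y i → ¬ G.Adj v z :=
      fun hi hv => not_adj_of_distLevel hconn hv hz (by omega)
    exact not_inducedPath_eight_vertices hP8 (a := p) (b := q) (c := U) (d := n) (e := z)
      (f := m) (g := W) (h := a) ⟨hpq, hqU, hUn, hnz, hmz.symm, hWm.symm, hWa⟩
      ⟨hpU, far31 hp hn, far (by omega) hp, far31 hp hm, hpW, hpa⟩
      ⟨far31 hq hn, far (by omega) hq, far31 hq hm, hqW, hqa⟩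
      ⟨far le_rfl hU, hUm, hUW, haU⟩ ⟨hN1 n hn m hm, hWn, far13 hn ha⟩
      ⟨fun h => far le_rfl hW h.symm, fun h => far (by omega) ha h.symm⟩ (far13 hm ha)
  have split : ∀ z ∈ distLevel G x y 0, ∀ z' ∈ distLevel G x y 0, G.Adj z z' →
      G.Adj n z → G.Adj m z' → ¬ G.Adj n z' → ¬ G.Adj m z → False := by
    intro z hz z' hz' hzz' hnz hmz' hnz' hmz
    have far : ∀ {v w : V} {i : ℕ}, 2 ≤ i → v ∈ distLevel G x y i → w ∈ distLevel G x y 0 →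
        ¬ G.Adj v w :=
      fun hi hv hw => not_adj_of_distLevel hconn hv hw (by omega)
    exact not_inducedPath_eight_vertices hP8 (a := p) (b := q) (c := U) (d := n) (e := z)
      (f := z') (g := m) (h := W) ⟨hpq, hqU, hUn, hnz, hzz', hmz'.symm, hWm.symm⟩
      ⟨hpU, far31 hp hn, far (by omega) hp hz, far (by omega) hp hz', far31 hp hm, hpW⟩
      ⟨far31 hq hn, far (by omega) hq hz, far (by omega) hq hz', far31 hq hm, hqW⟩
      ⟨far le_rfl hU hz, far le_rfl hU hz', hUm, hUW⟩ ⟨hnz', hN1 n hn m hm, hWn⟩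
      ⟨fun h => hmz h.symm, fun h => far le_rfl hW hz h.symm⟩
      (fun h => far le_rfl hW hz' h.symm)
  have hx0 := left_mem_distLevel_zero (G := G) (x := x) (y := y)
  have hy0 := right_mem_distLevel_zero (G := G) (x := x) (y := y)
  have hcx := common x hx0
  have hcy := common y hy0
  rcases adj_of_mem_distLevel_one hn with hnx | hny <;>
    rcases adj_of_mem_distLevel_one hm with hmx | hmy
  · exact hcx hnx hmx
  · exact split x hx0 y hy0 hxy hnx hmy (fun h => hcy h hmy) (fun h => hcx hnx h)
  · exact split y hy0 x hx0 hxy.symm hny hmx (fun h => hcx h hmx) (fun h => hcy hny h)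
  · exact hcy hny hmy

theorem adj_of_mem_Tset {t w : V} (ht : t ∈ Tset G x y w) : G.Adj t w := by
  have : w ∈ G.neighborSet t ∩ distLevel G x y 2 := by rw [ht.2]; rfl
  exact this.1

theorem not_adj_of_mem_Tset {t w z : V} (ht : t ∈ Tset G x y w) (hz : z ∈ distLevel G x y 2)
    (hzw : z ≠ w) : ¬ G.Adj t z := fun h => by
  have : z ∈ G.neighborSet t ∩ distLevel G x y 2 := ⟨h, hz⟩
  rw [ht.2] at this
  exact hzw this

end Levels

section Matching

variable {V : Type*} {G : SimpleGraph V} {M : Set (Sym2 V)}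

theorem IsDIM.eq_of_adj (hM : IsDIM G M) {a b : V} (hab : G.Adj a b) {f g : Sym2 V}
    (hf : f ∈ M) (hg : g ∈ M) (haf : a ∈ f) (hbg : b ∈ g) : f = g :=
  (hM.2 s(a, b) hab).unique ⟨hf, a, by simp, haf⟩ ⟨hg, b, by simp, hbg⟩

theorem IsDIM.exists_of_adj (hM : IsDIM G M) {a b : V} (hab : G.Adj a b) :
    ∃ f ∈ M, a ∈ f ∨ b ∈ f := by
  obtain ⟨f, ⟨hf, v, hv, hvf⟩, -⟩ := hM.2 s(a, b) hab
  rcases Sym2.mem_iff.mp hv with rfl | rfl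
  · exact ⟨f, hf, Or.inl hvf⟩
  · exact ⟨f, hf, Or.inr hvf⟩

theorem IsDIM.not_adj_of_distLevel_one (hM : IsDIM G M) {x y : V} (hxy : s(x, y) ∈ M)
    {a b : V} (ha : a ∈ distLevel G x y 1) (hb : b ∈ distLevel G x y 1) : ¬ G.Adj a b := by
  have unmatched : ∀ c ∈ distLevel G x y 1, ∀ f ∈ M, c ∉ f := by
    intro c hc f hf hcf
    have hfx : f = s(x, y) := by
      rcases adj_of_mem_distLevel_one hc with h | h
      · exact hM.eq_of_adj h hf hxy hcf (by simp)
      · exact hM.eq_of_adj h hf hxy hcf (by simp)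
    rw [hfx] at hcf
    rcases Sym2.mem_iff.mp hcf with rfl | rfl
    · exact absurd (distLevel_unique hc left_mem_distLevel_zero) (by omega)
    · exact absurd (distLevel_unique hc right_mem_distLevel_zero) (by omega)
  intro hab
  obtain ⟨f, hf, h | h⟩ := hM.exists_of_adj hab
  · exact unmatched a ha f hf h
  · exact unmatched b hb f hf h

/-- A triangle cannot have its vertices hanging off three distinct edges of a d.i.m. -/
theorem IsDIM.not_triangle (hM : IsDIM G M) {a b c a' b' c' : V} {e f g : Sym2 V}
    (he : e ∈ M) (hf : f ∈ M) (hg : g ∈ M) (hae : a' ∈ e) (hbf : b' ∈ f) (hcg : c' ∈ g)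
    (haa : G.Adj a a') (hbb : G.Adj b b') (hcc : G.Adj c c')
    (hef : e ≠ f) (heg : e ≠ g) (hfg : f ≠ g)
    (hab : G.Adj a b) (hac : G.Adj a c) (hbc : G.Adj b c) : False := by
  have ea : ∀ h ∈ M, a ∈ h → h = e := fun h hh hah => hM.eq_of_adj haa hh he hah hae
  have eb : ∀ h ∈ M, b ∈ h → h = f := fun h hh hbh => hM.eq_of_adj hbb hh hf hbh hbf
  have ec : ∀ h ∈ M, c ∈ h → h = g := fun h hh hch => hM.eq_of_adj hcc hh hg hch hcg
  have nab : ¬ (a ∈ e ∧ b ∈ f) := fun h => hef (hM.eq_of_adj hab he hf h.1 h.2)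
  have nac : ¬ (a ∈ e ∧ c ∈ g) := fun h => heg (hM.eq_of_adj hac he hg h.1 h.2)
  have nbc : ¬ (b ∈ f ∧ c ∈ g) := fun h => hfg (hM.eq_of_adj hbc hf hg h.1 h.2)
  have oab : a ∈ e ∨ b ∈ f := by
    obtain ⟨h, hh, h1 | h1⟩ := hM.exists_of_adj hab
    · exact Or.inl (ea h hh h1 ▸ h1)
    · exact Or.inr (eb h hh h1 ▸ h1)
  have oac : a ∈ e ∨ c ∈ g := by
    obtain ⟨h, hh, h1 | h1⟩ := hM.exists_of_adj hac
    · exact Or.inl (ea h hh h1 ▸ h1)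
    · exact Or.inr (ec h hh h1 ▸ h1)
  have obc : b ∈ f ∨ c ∈ g := by
    obtain ⟨h, hh, h1 | h1⟩ := hM.exists_of_adj hbc
    · exact Or.inl (eb h hh h1 ▸ h1)
    · exact Or.inr (ec h hh h1 ▸ h1)
  tauto

end Matching

theorem not_adj_of_diamond_free {V : Type*} {G : SimpleGraph V}
    (hDia : IsEmpty (diamondGraph ↪g G)) {a b c d : V} (hab : G.Adj a b) (hac : G.Adj a c)
    (hbc : G.Adj b c) (hbd : G.Adj b d) (had : ¬ G.Adj a d) (hne : a ≠ d) : ¬ G.Adj c d := by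
  intro hcd
  refine hDia.false ⟨⟨![a, b, c, d], ?_⟩, ?_⟩
  · intro i j hij
    have := hab.ne
    have := hac.ne
    have := hbc.ne
    have := hbd.ne
    have := hcd.ne
    fin_cases i <;> fin_cases j <;> simp_all
  · intro i j
    change G.Adj (![a, b, c, d] i) (![a, b, c, d] j) ↔ diamondGraph.Adj i j
    have hda : ¬ G.Adj d a := fun h => had h.symm
    fin_cases i <;> fin_cases j <;>
      simp [diamondGraph, hab, hac, hbc, hbd, hcd, hab.symm, hac.symm, hbc.symm, hbd.symm,
        hcd.symm, had, hda]

/-- Lemma 4: with `N₄ = ∅`, `S₃ = ∅`, no vertex of a `T_i` seeing two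
vertices of a `T_j`, and an edge `t₁t₂` between `T_{i₁}` and `T_{i₂}`; in the subgraph
`G'` induced by the vertices distinct from and nonadjacent to `t₁, t₂`: (i) each edge
inside a `T_i` misses all other `T_j`'s, and (ii) each vertex of a `T_i` sees at most one
vertex of the other `T_j`'s. -/
theorem stmt14 {V : Type*} [Fintype V] [DecidableEq V]
    (G : SimpleGraph V) (hconn : G.Connected)
    (hP8 : IsEmpty (SimpleGraph.pathGraph 8 ↪g G))
    (hK4 : IsEmpty ((⊤ : SimpleGraph (Fin 4)) ↪g G))
    (hDia : IsEmpty (diamondGraph ↪g G))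
    (hBut : IsEmpty (butterflyGraph ↪g G))
    (M : Set (Sym2 V)) (hM : IsDIM G M)
    (x y : V) (hxy : s(x, y) ∈ M)
    (r : V) (hrx : G.Adj r x) (hry : r ≠ y) (hrny : ¬ G.Adj r y)
    (hN2M : ∀ a b : V, a ∈ distLevel G x y 2 → b ∈ distLevel G x y 2 → s(a, b) ∉ M)
    (k : ℕ) (u : Fin k → V) (huinj : Function.Injective u)
    (hurange : Set.range u = distLevel G x y 2)
    (u' : Fin k → V) (hu3 : ∀ i, u' i ∈ distLevel G x y 3)
    (huM : ∀ i, s(u i, u' i) ∈ M)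
    (hN4 : distLevel G x y 4 = ∅)
    (hS3 : distLevel G x y 3 \ ⋃ i : Fin k, Tset G x y (u i) = ∅)
    (hno2 : ∀ i j : Fin k, i ≠ j → ∀ t ∈ Tset G x y (u i), ∀ a ∈ Tset G x y (u j),
      ∀ b ∈ Tset G x y (u j), G.Adj t a → G.Adj t b → a = b)
    (i1 i2 : Fin k) (hi12 : i1 ≠ i2)
    (t1 t2 : V) (ht1 : t1 ∈ Tset G x y (u i1)) (ht2 : t2 ∈ Tset G x y (u i2))
    (ht12 : G.Adj t1 t2) :
    ∀ i : Fin k, i ≠ i1 → i ≠ i2 →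
      ((∀ t t' : V, t ∈ Tset G x y (u i) → t' ∈ Tset G x y (u i) →
        t ∈ avoidSet G t1 t2 → t' ∈ avoidSet G t1 t2 → G.Adj t t' →
        ∀ j : Fin k, j ≠ i1 → j ≠ i2 → j ≠ i →
        ∀ w ∈ Tset G x y (u j), w ∈ avoidSet G t1 t2 →
          ¬ G.Adj t w ∧ ¬ G.Adj t' w) ∧
       (∀ t ∈ Tset G x y (u i), t ∈ avoidSet G t1 t2 →
        ∀ a b : V, a ∈ avoidSet G t1 t2 → b ∈ avoidSet G t1 t2 →
        (∃ j : Fin k, j ≠ i1 ∧ j ≠ i2 ∧ j ≠ i ∧ a ∈ Tset G x y (u j)) →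
        (∃ j : Fin k, j ≠ i1 ∧ j ≠ i2 ∧ j ≠ i ∧ b ∈ Tset G x y (u j)) →
        G.Adj t a → G.Adj t b → a = b)) := by
  intro i hi1 hi2
  have hu2 : ∀ j, u j ∈ distLevel G x y 2 := fun j => hurange ▸ Set.mem_range_self j
  have matchNe : ∀ j l : Fin k, j ≠ l → s(u j, u' j) ≠ s(u l, u' l) := by
    intro j l hjl h
    have hmem : u j ∈ s(u l, u' l) := h ▸ Sym2.mem_mk_left _ _
    rcases Sym2.mem_iff.mp hmem with h' | h'
    · exact hjl (huinj h')
    · exact absurd (distLevel_unique (hu2 j) (h' ▸ hu3 l)) (by omega)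
  have hN2 : ∀ j l : Fin k, j ≠ l → ¬ G.Adj (u j) (u l) := fun j l hjl h =>
    matchNe j l hjl (hM.eq_of_adj h (huM j) (huM l) (by simp) (by simp))
  have off : ∀ {j l : Fin k} {v : V}, v ∈ Tset G x y (u j) → l ≠ j → ¬ G.Adj v (u l) :=
    fun hv hlj => not_adj_of_mem_Tset hv (hu2 _) fun h => hlj (huinj h)
  have noPath : ∀ {j l : Fin k} {a t s : V}, j ≠ i1 → j ≠ i2 → j ≠ i → l ≠ i2 → l ≠ j →
      a ∈ Tset G x y (u j) → t ∈ Tset G x y (u i) → s ∈ Tset G x y (u l) →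
      a ∈ avoidSet G t1 t2 → t ∈ avoidSet G t1 t2 → s ∈ avoidSet G t1 t2 →
      G.Adj a t → G.Adj t s → ¬ G.Adj a s → False := by
    intro j l a t s hj1 hj2 hji hl2 hlj ha ht hs haA htA hsA hat hts has
    obtain ⟨-, -, ha1, ha2⟩ := haA
    obtain ⟨-, -, ht1', ht2'⟩ := htA
    obtain ⟨-, -, hs1, hs2⟩ := hsA
    refine false_of_edge_and_path_in_distLevel_three hconn hP8 (hM.1 hxy)
      (fun _ ha _ hb => hM.not_adj_of_distLevel_one hxy ha hb) (hu2 i2) (hu2 j)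
      (hN2 _ _ hj2.symm) ht1.1 ht2.1 ha.1 ht.1 hs.1 ht12 (adj_of_mem_Tset ht2)
      (adj_of_mem_Tset ha).symm hat hts has (off ht1 hi12.symm) (off ht1 hj1) (off ht2 hj2)
      ?_ ?_ ?_ ?_ ?_ ?_ ?_ ?_ ?_ ?_ ?_ <;> rw [G.adj_comm]
    · exact off ha hj2.symm
    · exact off ht hi2.symm
    · exact off hs hl2.symm
    · exact off ht hji
    · exact off hs hlj.symm
    all_goals assumption
  have edgeMiss : ∀ {j : Fin k} {t t' w : V}, j ≠ i1 → j ≠ i2 → j ≠ i →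
      t ∈ Tset G x y (u i) → t' ∈ Tset G x y (u i) → w ∈ Tset G x y (u j) →
      t ∈ avoidSet G t1 t2 → t' ∈ avoidSet G t1 t2 → w ∈ avoidSet G t1 t2 →
      G.Adj t t' → ¬ G.Adj t w := by
    intro j t t' w hj1 hj2 hji ht ht' hw htA ht'A hwA htt' htw
    have hwu : ¬ G.Adj w (u i) := off hw hji.symm
    have hne : u i ≠ w := fun h =>
      absurd (distLevel_unique (h ▸ hu2 i) hw.1) (by omega)
    have ht'w : ¬ G.Adj t' w := not_adj_of_diamond_free hDia (adj_of_mem_Tset ht).symm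
      (adj_of_mem_Tset ht').symm htt' htw (fun h => hwu h.symm) hne
    exact noPath hj1 hj2 hji hi2 hji.symm hw ht ht' hwA htA ht'A htw.symm htt'
      (fun h => ht'w h.symm)
  refine ⟨?_, ?_⟩
  · intro t t' ht ht' htA ht'A htt' j hj1 hj2 hji w hw hwA
    exact ⟨edgeMiss hj1 hj2 hji ht ht' hw htA ht'A hwA htt',
      edgeMiss hj1 hj2 hji ht' ht hw ht'A htA hwA htt'.symm⟩
  · rintro t ht htA a b haA hbA ⟨j, hj1, hj2, hji, ha⟩ ⟨l, hl1, hl2, hli, hb⟩ hta htb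
    by_cases hlj : l = j
    · subst hlj
      exact hno2 i l hli.symm t ht a ha b hb hta htb
    · refine (noPath hj1 hj2 hji hl2 hlj ha ht hb haA htA hbA hta.symm htb fun hab => ?_).elim
      exact hM.not_triangle (huM i) (huM j) (huM l) (Sym2.mem_mk_left _ _)
        (Sym2.mem_mk_left _ _) (Sym2.mem_mk_left _ _) (adj_of_mem_Tset ht) (adj_of_mem_Tset ha)
        (adj_of_mem_Tset hb) (matchNe _ _ hji.symm) (matchNe _ _ hli.symm)
        (matchNe _ _ (Ne.symm hlj)) hta htb hab
end

section
/- Under the standing setup, assume additionally that no edge of M has both endpoints in N_2 and that no vertex of N_3 is adjacent to both endpoints of an edge whose two endpoints lie in N_4. Then the subgraph induced by N_4(xy) contains no induced path P_3; equivalently, every connected component of G[N_4] is a clique. -/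
open SimpleGraph

/-- The distance from `z` to the pair `{x, y}`. -/
noncomputable def pairDist {V : Type*} (G : SimpleGraph V) (x y z : V) : ℕ := min (G.dist z x) (G.dist z y)

section DIM

variable {V : Type*} {G : SimpleGraph V} {M : Set (Sym2 V)}

theorem IsDIM.mem_or_mem (hM : IsDIM G M) {u v : V} (h : G.Adj u v) :
    u ∈ MVerts M ∨ v ∈ MVerts M := by
  obtain ⟨f, ⟨hf, w, hw, hwf⟩, -⟩ := hM.2 s(u, v) h
  rcases Sym2.mem_iff.1 hw with rfl | rfl
  · exact Or.inl ⟨f, hf, hwf⟩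
  · exact Or.inr ⟨f, hf, hwf⟩

theorem IsDIM.exists_mate (hM : IsDIM G M) {u : V} (hu : u ∈ MVerts M) :
    ∃ v ∈ MVerts M, G.Adj u v := by
  obtain ⟨f, hf, huf⟩ := hu
  obtain ⟨v, rfl⟩ := Sym2.mem_iff_exists.1 huf
  exact ⟨v, ⟨_, hf, Sym2.mem_mk_right u v⟩, hM.1 hf⟩

theorem IsDIM.mk_mem (hM : IsDIM G M) {u v : V} (hu : u ∈ MVerts M) (hv : v ∈ MVerts M)
    (h : G.Adj u v) : s(u, v) ∈ M := by
  obtain ⟨f, hf, huf⟩ := hu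
  obtain ⟨g, hg, hvg⟩ := hv
  have hfg : f = g := (hM.2 s(u, v) h).unique
    ⟨hf, u, Sym2.mem_mk_left u v, huf⟩ ⟨hg, v, Sym2.mem_mk_right u v, hvg⟩
  subst hfg
  rwa [← (Sym2.mem_and_mem_iff h.ne).1 ⟨huf, hvg⟩]

theorem IsDIM.mate_unique (hM : IsDIM G M) {u v w : V} (hu : u ∈ MVerts M)
    (hv : v ∈ MVerts M) (hw : w ∈ MVerts M) (huv : G.Adj u v) (huw : G.Adj u w) : v = w := by
  have h : s(u, v) = s(u, w) := (hM.2 s(u, v) huv).unique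
    ⟨hM.mk_mem hu hv huv, u, Sym2.mem_mk_left u v, Sym2.mem_mk_left u v⟩
    ⟨hM.mk_mem hu hw huw, u, Sym2.mem_mk_left u v, Sym2.mem_mk_left u w⟩
  exact Sym2.congr_right.1 h

end DIM

section Levels

variable {V : Type*} {G : SimpleGraph V} {x y : V}

theorem pairDist_le_of_adj (hconn : G.Connected) {u v : V} (h : G.Adj u v) :
    pairDist G x y v ≤ pairDist G x y u + 1 := by
  have h1 : G.dist v u = 1 := SimpleGraph.dist_eq_one_iff_adj.2 h.symm
  have hx := hconn.dist_triangle (u := v) (v := u) (w := x)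
  have hy := hconn.dist_triangle (u := v) (v := u) (w := y)
  unfold pairDist
  omega

theorem not_adj_of_pairDist_lt (hconn : G.Connected) {u v : V}
    (h : pairDist G x y v + 1 < pairDist G x y u) : ¬ G.Adj u v := fun huv => by
  have := pairDist_le_of_adj (x := x) (y := y) hconn huv.symm
  omega

theorem exists_adj_dist_eq (hconn : G.Connected) {z t : V} {n : ℕ} (h : G.dist z t = n + 1) :
    ∃ u, G.Adj z u ∧ G.dist u t = n := by
  obtain ⟨p, hp⟩ := hconn.exists_walk_length_eq_dist z t
  cases p with
  | nil => simp at h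
  | @cons _ u _ huv q =>
    refine ⟨u, huv, ?_⟩
    have h1 := SimpleGraph.dist_le q
    have h2 := hconn.dist_triangle (u := z) (v := u) (w := t)
    rw [SimpleGraph.dist_eq_one_iff_adj.2 huv] at h2
    rw [SimpleGraph.Walk.length_cons] at hp
    omega

theorem exists_adj_pairDist_eq (hconn : G.Connected) {z : V} {n : ℕ}
    (h : pairDist G x y z = n + 1) : ∃ u, G.Adj z u ∧ pairDist G x y u = n := by
  have key : ∃ u, G.Adj z u ∧ pairDist G x y u ≤ n := by
    rcases min_choice (G.dist z x) (G.dist z y) with hm | hm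
    · obtain ⟨u, hu, hd⟩ := exists_adj_dist_eq hconn (hm.symm.trans h)
      exact ⟨u, hu, (min_le_left _ _).trans hd.le⟩
    · obtain ⟨u, hu, hd⟩ := exists_adj_dist_eq hconn (hm.symm.trans h)
      exact ⟨u, hu, (min_le_right _ _).trans hd.le⟩
  obtain ⟨u, hu, hle⟩ := key
  have := pairDist_le_of_adj (x := x) (y := y) hconn hu.symm
  exact ⟨u, hu, by omega⟩

theorem pairDist_left : pairDist G x y x = 0 := by simp [pairDist]

theorem pairDist_right : pairDist G x y y = 0 := by simp [pairDist]

theorem eq_or_eq_of_pairDist_eq_zero (hconn : G.Connected) {z : V}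
    (h : pairDist G x y z = 0) : z = x ∨ z = y := by
  rcases min_choice (G.dist z x) (G.dist z y) with hm | hm
  · exact Or.inl (hconn.dist_eq_zero_iff.1 (hm.symm.trans h))
  · exact Or.inr (hconn.dist_eq_zero_iff.1 (hm.symm.trans h))

variable {M : Set (Sym2 V)}

theorem IsDIM.notMem_of_pairDist_eq_one (hconn : G.Connected) (hM : IsDIM G M)
    (hxy : s(x, y) ∈ M) {z : V} (hz : pairDist G x y z = 1) : z ∉ MVerts M := by
  intro hzM
  have hxM : x ∈ MVerts M := ⟨_, hxy, Sym2.mem_mk_left x y⟩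
  have hyM : y ∈ MVerts M := ⟨_, hxy, Sym2.mem_mk_right x y⟩
  have hadj : G.Adj x y := hM.1 hxy
  obtain ⟨u, hu, hu0⟩ := exists_adj_pairDist_eq hconn hz
  rcases eq_or_eq_of_pairDist_eq_zero hconn hu0 with rfl | rfl
  · have := hM.mate_unique hxM hzM hyM hu.symm hadj
    rw [this, pairDist_right] at hz
    omega
  · have := hM.mate_unique hyM hzM hxM hu.symm hadj.symm
    rw [this, pairDist_left] at hz
    omega

theorem IsDIM.mem_of_pairDist_eq_two (hconn : G.Connected) (hM : IsDIM G M)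
    (hxy : s(x, y) ∈ M) {z : V} (hz : pairDist G x y z = 2) : z ∈ MVerts M := by
  obtain ⟨u, hu, hu1⟩ := exists_adj_pairDist_eq hconn hz
  exact (hM.mem_or_mem hu).resolve_right (hM.notMem_of_pairDist_eq_one hconn hxy hu1)

/-- A vertex at distance two from `{x, y}` starts a chordless path on four vertices whose other
vertices are at distance at most one from `{x, y}`. -/
theorem exists_path_of_pairDist_eq_two (hconn : G.Connected) (hM : IsDIM G M)
    (hxy : s(x, y) ∈ M) {r : V} (hrx : G.Adj r x) (hry : r ≠ y) (hrny : ¬ G.Adj r y)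
    {w : V} (hw : pairDist G x y w = 2) :
    ∃ u p q, pairDist G x y u ≤ 1 ∧ pairDist G x y p ≤ 1 ∧ pairDist G x y q ≤ 1 ∧
      G.Adj w u ∧ G.Adj u p ∧ G.Adj p q ∧ ¬ G.Adj w p ∧ ¬ G.Adj w q ∧ ¬ G.Adj u q ∧ u ≠ q := by
  have hadj : G.Adj x y := hM.1 hxy
  have hx0 : pairDist G x y x = 0 := pairDist_left
  have hy0 : pairDist G x y y = 0 := pairDist_right
  have hwx : ¬ G.Adj w x := not_adj_of_pairDist_lt (x := x) (y := y) hconn (by omega)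
  have hwy : ¬ G.Adj w y := not_adj_of_pairDist_lt (x := x) (y := y) hconn (by omega)
  have hr : pairDist G x y r = 1 := by
    have h1 := pairDist_le_of_adj (x := x) (y := y) hconn hrx.symm
    by_contra hne
    rcases eq_or_eq_of_pairDist_eq_zero hconn (by omega : pairDist G x y r = 0) with h | h
    · exact hrx.ne h
    · exact hry h
  obtain ⟨u, hwu, hu1⟩ := exists_adj_pairDist_eq hconn hw
  have hux : u ≠ x := by rintro rfl; omega
  have huy : u ≠ y := by rintro rfl; omega
  by_cases ux : G.Adj u x
  · by_cases uy : G.Adj u y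
    · by_cases wr : G.Adj w r
      · exact ⟨r, x, y, hr.le, by omega, by omega, wr, hrx, hadj, hwx, hwy, hrny, hry⟩
      · have hur : ¬ G.Adj u r := fun h => (hM.mem_or_mem h).elim
          (hM.notMem_of_pairDist_eq_one hconn hxy hu1)
          (hM.notMem_of_pairDist_eq_one hconn hxy hr)
        exact ⟨u, x, r, hu1.le, by omega, hr.le, hwu, ux, hrx.symm, hwx, wr, hur,
          by rintro rfl; exact wr hwu⟩
    · exact ⟨u, x, y, hu1.le, by omega, by omega, hwu, ux, hadj, hwx, hwy, uy, huy⟩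
  · have uy : G.Adj u y := by
      obtain ⟨t, ht, ht0⟩ := exists_adj_pairDist_eq hconn hu1
      rcases eq_or_eq_of_pairDist_eq_zero hconn ht0 with rfl | rfl
      · exact absurd ht ux
      · exact ht
    exact ⟨u, y, x, hu1.le, by omega, by omega, hwu, uy, hadj.symm, hwy, hwx, ux, hux⟩

end Levels

/-- A map from a linear order that respects adjacency and is injective on increasing pairs
is a graph embedding. -/
theorem nonempty_embedding_of_lt {V ι : Type*} [LinearOrder ι] {H : SimpleGraph ι}
    {G : SimpleGraph V} (f : ι → V)
    (h : ∀ i j, i < j → f i ≠ f j ∧ (G.Adj (f i) (f j) ↔ H.Adj i j)) : Nonempty (H ↪g G) := by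
  refine ⟨⟨⟨f, fun i j hij => ?_⟩, fun {i j} => ?_⟩⟩
  · rcases lt_trichotomy i j with hlt | heq | hlt
    · exact absurd hij (h i j hlt).1
    · exact heq
    · exact absurd hij.symm (h j i hlt).1
  · change G.Adj (f i) (f j) ↔ H.Adj i j
    rcases lt_trichotomy i j with hlt | rfl | hlt
    · exact (h i j hlt).2
    · simp
    · rw [G.adj_comm, H.adj_comm]
      exact (h j i hlt).2

theorem false_of_diamond {V : Type*} {G : SimpleGraph V} (hDia : IsEmpty (diamondGraph ↪g G))
    {a b c d : V} (hab : G.Adj a b) (hac : G.Adj a c) (hbc : G.Adj b c) (hbd : G.Adj b d)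
    (hcd : G.Adj c d) (had : ¬ G.Adj a d) (hne : a ≠ d) : False := by
  refine not_nonempty_iff.2 hDia (nonempty_embedding_of_lt ![a, b, c, d] ?_)
  intro i j hij
  fin_cases i <;> fin_cases j <;> first
    | exact absurd hij (by decide)
    | simp [diamondGraph, hab.ne, hac.ne, hbc.ne, hbd.ne, hcd.ne, *]

theorem false_of_butterfly {V : Type*} {G : SimpleGraph V}
    (hBut : IsEmpty (butterflyGraph ↪g G)) {a b c d e : V} (hab : G.Adj a b) (hac : G.Adj a c)
    (hbc : G.Adj b c) (hcd : G.Adj c d) (hce : G.Adj c e) (hde : G.Adj d e)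
    (had : ¬ G.Adj a d) (hae : ¬ G.Adj a e) (hbd : ¬ G.Adj b d) (hbe : ¬ G.Adj b e)
    (had' : a ≠ d) (hae' : a ≠ e) (hbd' : b ≠ d) (hbe' : b ≠ e) : False := by
  refine not_nonempty_iff.2 hBut (nonempty_embedding_of_lt ![a, b, c, d, e] ?_)
  intro i j hij
  fin_cases i <;> fin_cases j <;> first
    | exact absurd hij (by decide)
    | simp [butterflyGraph, hab.ne, hac.ne, hbc.ne, hcd.ne, hce.ne, hde.ne, *]

/-- In a `P₈`-free graph, a chordless path on four vertices cannot end at distance three from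
`{x, y}` while its other vertices are at distance at least four. -/
theorem false_of_path_above_level_three {V : Type*} {G : SimpleGraph V} (hconn : G.Connected)
    (hP8 : IsEmpty (SimpleGraph.pathGraph 8 ↪g G)) {M : Set (Sym2 V)} (hM : IsDIM G M)
    {x y r : V} (hxy : s(x, y) ∈ M) (hrx : G.Adj r x) (hry : r ≠ y) (hrny : ¬ G.Adj r y)
    {a b c d : V} (ha : 4 ≤ pairDist G x y a) (hb : 4 ≤ pairDist G x y b)
    (hc : 4 ≤ pairDist G x y c) (hd : pairDist G x y d = 3)
    (hab : G.Adj a b) (hbc : G.Adj b c) (hcd : G.Adj c d)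
    (hac : ¬ G.Adj a c) (hne : a ≠ c) (had : ¬ G.Adj a d) (hbd : ¬ G.Adj b d) : False := by
  obtain ⟨w, hdw, hw⟩ := exists_adj_pairDist_eq hconn hd
  obtain ⟨u, p, q, hu, hp, hq, hwu, hup, hpq, hwp, hwq, huq, huneq⟩ :=
    exists_path_of_pairDist_eq_two hconn hM hxy hrx hry hrny hw
  have far : ∀ {s t : V}, pairDist G x y t + 1 < pairDist G x y s → s ≠ t ∧ ¬ G.Adj s t :=
    fun {s t} h => ⟨by rintro rfl; omega, not_adj_of_pairDist_lt hconn h⟩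
  have haw := far (s := a) (t := w) (by omega)
  have hau := far (s := a) (t := u) (by omega)
  have hap := far (s := a) (t := p) (by omega)
  have haq := far (s := a) (t := q) (by omega)
  have hbw := far (s := b) (t := w) (by omega)
  have hbu := far (s := b) (t := u) (by omega)
  have hbp := far (s := b) (t := p) (by omega)
  have hbq := far (s := b) (t := q) (by omega)
  have hcw := far (s := c) (t := w) (by omega)
  have hcu := far (s := c) (t := u) (by omega)
  have hcp := far (s := c) (t := p) (by omega)
  have hcq := far (s := c) (t := q) (by omega)
  have hdu := far (s := d) (t := u) (by omega)
  have hdp := far (s := d) (t := p) (by omega)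
  have hdq := far (s := d) (t := q) (by omega)
  have had' : a ≠ d := by rintro rfl; omega
  have hbd' : b ≠ d := by rintro rfl; omega
  have hwp' : w ≠ p := by rintro rfl; omega
  have hwq' : w ≠ q := by rintro rfl; omega
  refine not_nonempty_iff.2 hP8 (nonempty_embedding_of_lt ![a, b, c, d, w, u, p, q] ?_)
  clear far hP8
  intro i j hij
  fin_cases i <;> fin_cases j <;> first
    | exact absurd hij (by decide)
    | simp [SimpleGraph.pathGraph_adj, hab.ne, hbc.ne, hcd.ne, hdw.ne, hwu.ne, hup.ne, hpq.ne, *]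

/-- Lemma 6: under the standing setup, if no edge of `M` lies inside `N₂`
and no vertex of `N₃` sees both endpoints of an edge inside `N₄`, then `G[N₄]` is
`P₃`-free, i.e. its connected components are cliques. -/
theorem stmt16 {V : Type*} [Fintype V] [DecidableEq V]
    (G : SimpleGraph V) (hconn : G.Connected)
    (hP8 : IsEmpty (SimpleGraph.pathGraph 8 ↪g G))
    (hK4 : IsEmpty ((⊤ : SimpleGraph (Fin 4)) ↪g G))
    (hDia : IsEmpty (diamondGraph ↪g G))
    (hBut : IsEmpty (butterflyGraph ↪g G))
    (M : Set (Sym2 V)) (hM : IsDIM G M)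
    (x y : V) (hxy : s(x, y) ∈ M)
    (r : V) (hrx : G.Adj r x) (hry : r ≠ y) (hrny : ¬ G.Adj r y)
    (hN2M : ∀ a b : V, a ∈ distLevel G x y 2 → b ∈ distLevel G x y 2 → s(a, b) ∉ M)
    (hTri : ∀ a ∈ distLevel G x y 3, ∀ b ∈ distLevel G x y 4, ∀ c ∈ distLevel G x y 4,
      G.Adj b c → ¬ (G.Adj a b ∧ G.Adj a c)) :
    ∀ a b c : V, a ∈ distLevel G x y 4 → b ∈ distLevel G x y 4 →
      c ∈ distLevel G x y 4 → G.Adj a b → G.Adj b c → a ≠ c → G.Adj a c := by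
  intro a b c ha hb hc hab hbc hne
  by_contra hac
  have ha4 : pairDist G x y a = 4 := ha
  have hb4 : pairDist G x y b = 4 := hb
  have hc4 : pairDist G x y c = 4 := hc
  have noPath : ∀ {s t u v : V}, 4 ≤ pairDist G x y s → 4 ≤ pairDist G x y t →
      4 ≤ pairDist G x y u → pairDist G x y v = 3 → G.Adj s t → G.Adj t u → G.Adj u v →
      ¬ G.Adj s u → s ≠ u → ¬ G.Adj s v → ¬ G.Adj t v → False :=
    fun hs ht hu hv => false_of_path_above_level_three hconn hP8 hM hxy hrx hry hrny hs ht hu hv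
  have adj_c : ∀ d, pairDist G x y d = 3 → G.Adj a d → G.Adj c d := fun d hd had => by
    by_contra hcd
    exact noPath hc4.ge hb4.ge ha4.ge hd hbc.symm hab.symm had (fun h => hac h.symm) hne.symm hcd
      fun hbd => hTri d hd a ha b hb hab ⟨had.symm, hbd.symm⟩
  have adj_a : ∀ d, pairDist G x y d = 3 → G.Adj c d → G.Adj a d := fun d hd hcd => by
    by_contra had
    exact noPath ha4.ge hb4.ge hc4.ge hd hab hbc hcd hac hne had
      fun hbd => hTri d hd b hb c hc hbc ⟨hbd.symm, hcd.symm⟩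
  obtain ⟨d, had, hd⟩ := exists_adj_pairDist_eq hconn ha4
  have hcd := adj_c d hd had
  have hbd : ¬ G.Adj b d := fun h => hTri d hd a ha b hb hab ⟨had.symm, h.symm⟩
  have hbd' : b ≠ d := by rintro rfl; omega
  by_cases hbM : b ∈ MVerts M
  · have haM : a ∉ MVerts M := fun haM => by
      rcases hM.mem_or_mem hcd with h | h
      · exact hne (hM.mate_unique hbM haM h hab.symm hbc)
      · exact hbd' (hM.mate_unique haM hbM h hab had)
    have hdM := (hM.mem_or_mem had).resolve_left haM
    obtain ⟨b', hb'M, hbb'⟩ := hM.exists_mate hbM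
    have hb'3 := pairDist_le_of_adj (x := x) (y := y) hconn hbb'.symm
    have hb' : 4 ≤ pairDist G x y b' := by
      by_contra hlt
      obtain ⟨w, hw, hw2⟩ :=
        exists_adj_pairDist_eq hconn (by omega : pairDist G x y b' = 2 + 1)
      have := hM.mate_unique hb'M hbM (hM.mem_of_pairDist_eq_two hconn hxy hw2) hbb'.symm hw
      rw [this] at hb4
      omega
    have hb'd : ¬ G.Adj b' d := fun h => hbd' (hM.mate_unique hb'M hbM hdM hbb'.symm h)
    by_cases hb'a : G.Adj b' a
    · by_cases hb'c : G.Adj b' c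
      · exact false_of_diamond hDia hab hb'a.symm hbb' hbc hb'c hac hne
      · exact noPath hb' hb4.ge hc4.ge hd hbb'.symm hbc hcd hb'c
          (by rintro rfl; exact hac hb'a.symm) hb'd hbd
    · refine noPath hb' hb4.ge ha4.ge hd hbb'.symm hab.symm had hb'a ?_ hb'd hbd
      rintro rfl
      exact haM hb'M
  · have haM := (hM.mem_or_mem hab).resolve_right hbM
    have hcM := (hM.mem_or_mem hbc).resolve_left hbM
    obtain ⟨a', ha'M, haa'⟩ := hM.exists_mate haM
    obtain ⟨c', hc'M, hcc'⟩ := hM.exists_mate hcM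
    have ha'c : ¬ G.Adj a' c := fun h => hne (hM.mate_unique ha'M haM hcM haa'.symm h)
    have hc'a : ¬ G.Adj c' a := fun h => hne (hM.mate_unique hc'M haM hcM h hcc'.symm)
    have ha'c' : ¬ G.Adj a' c' := fun h => hac <| by
      rw [hM.mate_unique ha'M haM hc'M haa'.symm h]
      exact hcc'.symm
    obtain ⟨e, hbe, he⟩ := exists_adj_pairDist_eq hconn hb4
    have heM := (hM.mem_or_mem hbe).resolve_left hbM
    have ha'3 := pairDist_le_of_adj (x := x) (y := y) hconn haa'.symm
    have hc'3 := pairDist_le_of_adj (x := x) (y := y) hconn hcc'.symm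
    have mate_adj : ∀ {s s' : V}, pairDist G x y s = 4 → G.Adj s b → s ∈ MVerts M →
        s' ∈ MVerts M → G.Adj s s' → pairDist G x y s' ≠ 3 → G.Adj s' b := by
      intro s s' hs hsb hsM hs'M hss' hs'
      by_contra hs'b
      have hle := pairDist_le_of_adj (x := x) (y := y) hconn hss'.symm
      refine noPath (by omega) hs.ge hb4.ge he hss'.symm hsb hbe hs'b
        (by rintro rfl; exact hbM hs'M) (fun h => ?_)
        (fun h => hTri e he s hs b hb hsb ⟨h.symm, hbe.symm⟩)
      have := hM.mate_unique hs'M hsM heM hss'.symm h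
      rw [this] at hs
      omega
    have ha'b : G.Adj a' b := mate_adj ha4 hab haM ha'M haa'
      fun h => ha'c (adj_c a' h haa').symm
    have hc'b : G.Adj c' b := mate_adj hc4 hbc.symm hcM hc'M hcc'
      fun h => hc'a (adj_a c' h hcc').symm
    have h1 : a' ≠ c := by rintro rfl; exact hac haa'
    have h2 : a ≠ c' := by rintro rfl; exact hac hcc'.symm
    have h3 : a' ≠ c' := by rintro rfl; exact ha'c hcc'.symm
    exact false_of_butterfly hBut haa' hab ha'b hbc hc'b.symm hcc' hac
      (fun h => hc'a h.symm) ha'c ha'c' hne h2 h1 h3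
end
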